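/- arXiv:2604.07408 — 3 statements merged into one kernel-verified Lean document; each statement's English description precedes it below -/
import Mathlib

section
/- Let G = (V,E) be a finite connected simple graph with n = |V| vertices. Then the number σ(G) of successive vertex orderings of G satisfies σ(G) = n! · Σ over independent sets I ⊆ V of (−1)^{|I|} · (a(I)/n) · b(I). -/
open Finset Polynomial

variable {V : Type*} [Fintype V] [DecidableEq V]

/-- The closed neighbourhood `N[I]` of a set of vertices `I`. -/
def closedNbhd (G : SimpleGraph V) [DecidableRel G.Adj] (I : Finset V) : Finset V :=
  I ∪ I.biUnion fun v => G.neighborFinset v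

/-- `a(I) = |V \ N[I]| = n - |N[I]|`. -/
def aPar (G : SimpleGraph V) [DecidableRel G.Adj] (I : Finset V) : ℕ :=
  Fintype.card V - (closedNbhd G I).card

/-- `I` is an independent set: no two of its vertices are adjacent. -/
def IsIndep (G : SimpleGraph V) (I : Finset V) : Prop :=
  ∀ u ∈ I, ∀ v ∈ I, ¬ G.Adj u v

instance (G : SimpleGraph V) [DecidableRel G.Adj] : DecidablePred (IsIndep G) :=
  fun I => inferInstanceAs (Decidable (∀ u ∈ I, ∀ v ∈ I, ¬ G.Adj u v))

/-- For a list `ρ = (ρ₁, …, ρ_k)`, the product `∏_{j=1}^k 1/(n - a({ρ_j, …, ρ_k}))`. -/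
def prodTerm (G : SimpleGraph V) [DecidableRel G.Adj] : List V → ℚ
  | [] => 1
  | v :: l =>
      (1 / ((Fintype.card V : ℚ) - (aPar G (v :: l).toFinset : ℚ))) * prodTerm G l

/-- `b(I)`: the sum over all permutations `ρ` of `I` of
`∏_{j=1}^k 1/(n - a({ρ_j, …, ρ_k}))`; in particular `b(∅) = 1`. -/
noncomputable def bPar (G : SimpleGraph V) [DecidableRel G.Adj] (I : Finset V) : ℚ :=
  (I.toList.permutations.map (prodTerm G)).sum

/-- A linear ordering `π : V ≃ Fin n` is successive if every vertex which is not first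
has a neighbour appearing earlier. -/
def IsSuccessive (G : SimpleGraph V) (π : V ≃ Fin (Fintype.card V)) : Prop :=
  ∀ v : V, (π v : ℕ) ≠ 0 → ∃ u : V, G.Adj u v ∧ π u < π v

/-- `σ(G)`: the number of successive linear orderings of the vertices of `G`. -/
noncomputable def sigmaG (G : SimpleGraph V) : ℕ :=
  Nat.card {π : V ≃ Fin (Fintype.card V) // IsSuccessive G π}

/-- Vertex `v` is bad in the ordering `π`: it is not first, yet appears before
all of its neighbours. -/
def IsBad (G : SimpleGraph V) (π : V ≃ Fin (Fintype.card V)) (v : V) : Prop :=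
  (π v : ℕ) ≠ 0 ∧ ∀ u : V, G.Adj u v → π v < π u

/-- Vertex `v` is good in the ordering `π`: it is first or some neighbour appears earlier. -/
def IsGood (G : SimpleGraph V) (π : V ≃ Fin (Fintype.card V)) (v : V) : Prop :=
  (π v : ℕ) = 0 ∨ ∃ u : V, G.Adj u v ∧ π u < π v

/-- For each `j`, the vertex `ρ_j` is the earliest element of `N[{ρ_j, …, ρ_k}]` under `π`. -/
def EarliestAll (G : SimpleGraph V) [DecidableRel G.Adj]
    (π : V ≃ Fin (Fintype.card V)) : List V → Prop
  | [] => True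
  | v :: l =>
      (∀ u ∈ closedNbhd G (v :: l).toFinset, u ≠ v → π v < π u) ∧ EarliestAll G π l

/-- The event `C_ρ`: the vertices of `ρ` appear in the relative order
`ρ₁ ≺ ρ₂ ≺ ⋯ ≺ ρ_k`, and each `ρ_j` is the earliest element of `N[{ρ_j, …, ρ_k}]`. -/
def CEvent (G : SimpleGraph V) [DecidableRel G.Adj]
    (π : V ≃ Fin (Fintype.card V)) (ρ : List V) : Prop :=
  ρ.Chain' (fun a b => π a < π b) ∧ EarliestAll G π ρ

/-- The weight `w(I) = (a(I)/n) · b(I)`. -/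
noncomputable def wPar (G : SimpleGraph V) [DecidableRel G.Adj] (I : Finset V) : ℚ :=
  ((aPar G I : ℚ) / (Fintype.card V : ℚ)) * bPar G I

/-- The successive ordering polynomial `P_G(x) = Σ_I w(I) x^{|I|}` over independent sets. -/
noncomputable def PG (G : SimpleGraph V) [DecidableRel G.Adj] : Polynomial ℚ :=
  ∑ I ∈ Finset.univ.filter (fun I : Finset V => IsIndep G I),
    Polynomial.C (wPar G I) * Polynomial.X ^ I.card

/-- `r(π)`: the number of bad vertices of the ordering `π`. -/
noncomputable def badCount (G : SimpleGraph V) (π : V ≃ Fin (Fintype.card V)) : ℕ :=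
  Nat.card {v : V // IsBad G π v}

/-- Closed neighbourhood inside the induced subgraph on the vertex set `W`. -/
def closW (G : SimpleGraph V) [DecidableRel G.Adj] (W I : Finset V) : Finset V :=
  closedNbhd G I ∩ W

/-- The parameter `a` computed in the induced subgraph on `W`. -/
def aW (G : SimpleGraph V) [DecidableRel G.Adj] (W I : Finset V) : ℕ :=
  W.card - (closW G W I).card

/-- The product term computed in the induced subgraph on `W`. -/
def prodTermW (G : SimpleGraph V) [DecidableRel G.Adj] (W : Finset V) : List V → ℚ
  | [] => 1
  | v :: l => (1 / ((W.card : ℚ) - (aW G W (v :: l).toFinset : ℚ))) * prodTermW G W l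

/-- The parameter `b` computed in the induced subgraph on `W`. -/
noncomputable def bW (G : SimpleGraph V) [DecidableRel G.Adj] (W I : Finset V) : ℚ :=
  (I.toList.permutations.map (prodTermW G W)).sum

/-- The weight `w` computed in the induced subgraph on `W`. -/
noncomputable def wW (G : SimpleGraph V) [DecidableRel G.Adj] (W I : Finset V) : ℚ :=
  ((aW G W I : ℚ) / (W.card : ℚ)) * bW G W I

/-- The successive ordering polynomial of the induced subgraph on `W`. -/
noncomputable def PW (G : SimpleGraph V) [DecidableRel G.Adj] (W : Finset V) : Polynomial ℚ :=
  ∑ I ∈ W.powerset.filter (fun I : Finset V => IsIndep G I),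
    Polynomial.C (wW G W I) * Polynomial.X ^ I.card

/-- The multivariate successive ordering polynomial `𝒫_G(x) = Σ_I w(I) ∏_{v ∈ I} x_v`. -/
noncomputable def mvP (G : SimpleGraph V) [DecidableRel G.Adj] : MvPolynomial V ℚ :=
  ∑ I ∈ Finset.univ.filter (fun I : Finset V => IsIndep G I),
    MvPolynomial.C (wPar G I) * ∏ v ∈ I, MvPolynomial.X v

theorem mem_closedNbhd (G : SimpleGraph V) [DecidableRel G.Adj] {I : Finset V} {u : V} :
    u ∈ closedNbhd G I ↔ u ∈ I ∨ ∃ v ∈ I, G.Adj v u := by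
  simp [closedNbhd]

theorem card_sub_aPar (G : SimpleGraph V) [DecidableRel G.Adj] (I : Finset V) :
    (Fintype.card V : ℚ) - aPar G I = (closedNbhd G I).card := by
  rw [aPar, Nat.cast_sub (card_le_univ _)]
  ring

/-- `π` and `π₀` have the same first `m` vertices, in the same order. -/
def AgreesBelow (π₀ : V ≃ Fin (Fintype.card V)) (m : ℕ) (π : V ≃ Fin (Fintype.card V)) : Prop :=
  ∀ v, (π₀ v : ℕ) < m → π v = π₀ v

theorem AgreesBelow.le_apply {π₀ π : V ≃ Fin (Fintype.card V)} {m : ℕ}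
    (h : AgreesBelow π₀ m π) {v : V} (hv : m ≤ (π₀ v : ℕ)) : m ≤ (π v : ℕ) := by
  by_contra! hlt
  have h1 : (π₀ (π₀.symm (π v)) : ℕ) < m := by simpa using hlt
  have h2 := h _ h1
  rw [Equiv.apply_symm_apply] at h2
  have h3 := π.injective h2
  rw [h3] at h1
  omega

/-- Prescribing the vertex `w` in position `m` lengthens the prescribed prefix by one. -/
theorem exists_agreesBelow_succ (π₀ : V ≃ Fin (Fintype.card V)) {m : ℕ} {w : V}
    (hw : m ≤ (π₀ w : ℕ)) :
    ∃ π₁ : V ≃ Fin (Fintype.card V),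
      (∀ π, AgreesBelow π₁ (m + 1) π ↔ AgreesBelow π₀ m π ∧ (π w : ℕ) = m) ∧
      ∀ v, v ≠ w → m ≤ (π₀ v : ℕ) → m + 1 ≤ (π₁ v : ℕ) := by
  have hm : m < Fintype.card V := hw.trans_lt (π₀ w).2
  set π₁ := π₀.trans (Equiv.swap (π₀ w) ⟨m, hm⟩) with hπ₁
  have h_w : π₁ w = ⟨m, hm⟩ := by simp [hπ₁]
  have h_lt : ∀ v, (π₀ v : ℕ) < m → π₁ v = π₀ v := by
    intro v hv
    simp only [hπ₁, Equiv.trans_apply]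
    apply Equiv.swap_apply_of_ne_of_ne
    · intro h
      rw [h] at hv
      omega
    · intro h
      rw [h] at hv
      exact lt_irrefl _ hv
  have h_ge : ∀ v, v ≠ w → m ≤ (π₀ v : ℕ) → m + 1 ≤ (π₁ v : ℕ) := by
    intro v hvw hv
    have h1 : m ≤ (π₁ v : ℕ) := AgreesBelow.le_apply h_lt hv
    have h2 : (π₁ v : ℕ) ≠ m := fun h => hvw (π₁.injective (by rw [h_w]; exact Fin.ext h))
    omega
  refine ⟨π₁, fun π => ⟨fun h => ⟨fun v hv => ?_, ?_⟩, fun h v hv => ?_⟩, h_ge⟩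
  · rw [h v (by rw [h_lt v hv]; omega), h_lt v hv]
  · rw [h w (by rw [h_w]; simp), h_w]
  · by_cases hvw : v = w
    · subst hvw
      rw [h_w]
      exact Fin.ext h.2
    · have hlt : (π₀ v : ℕ) < m := by
        by_contra! hge
        have := h_ge v hvw hge
        omega
      rw [h.1 v hlt, h_lt v hlt]

open Classical in
theorem card_agreesBelow_eq_sum (π₀ : V ≃ Fin (Fintype.card V)) {m : ℕ}
    (hm : m < Fintype.card V) (P : (V ≃ Fin (Fintype.card V)) → Prop) :
    #{π | AgreesBelow π₀ m π ∧ P π} =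
      ∑ w with m ≤ (π₀ w : ℕ), #{π | (AgreesBelow π₀ m π ∧ (π w : ℕ) = m) ∧ P π} := by
  rw [card_eq_sum_card_fiberwise (f := fun π => π.symm ⟨m, hm⟩)
    (t := univ.filter fun w => m ≤ (π₀ w : ℕ))]
  · refine sum_congr rfl fun w _ => ?_
    rw [filter_filter]
    congr 1
    ext π
    simp only [mem_filter, mem_univ, true_and, Equiv.symm_apply_eq, Fin.ext_iff]
    tauto
  · intro π hπ
    simp only [coe_filter, mem_univ, true_and, Set.mem_ofPred_eq] at hπ ⊢
    by_contra! hlt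
    have := hπ.1 _ hlt
    rw [Equiv.apply_symm_apply] at this
    rw [← this] at hlt
    exact lt_irrefl _ hlt

theorem card_filter_le_apply (π₀ : V ≃ Fin (Fintype.card V)) {m k : ℕ}
    (hmk : m + k = Fintype.card V) : #{w | m ≤ (π₀ w : ℕ)} = k := by
  rw [card_bij' (t := univ.filter fun i : Fin (Fintype.card V) => m ≤ (i : ℕ))
    (fun w _ => π₀ w) (fun i _ => π₀.symm i) (by simp) (by simp) (by simp) (by simp)]
  have h := card_filter_add_card_filter_not (s := (univ : Finset (Fin (Fintype.card V))))
    (fun i => (i : ℕ) < m)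
  simp only [not_lt, card_univ, Fintype.card_fin] at h
  rw [Fin.card_filter_val_lt] at h
  omega

/-- The number of orderings with a prescribed prefix of length `m = n - k` that realise the event
`EarliestAll` of a list `l` whose closed neighbourhood avoids this prefix. -/
theorem card_agreesBelow_earliestAll (G : SimpleGraph V) [DecidableRel G.Adj] (k : ℕ) :
    ∀ (π₀ : V ≃ Fin (Fintype.card V)) (m : ℕ), m + k = Fintype.card V →
    ∀ l : List V, l.Nodup → IsIndep G l.toFinset →
    (∀ u ∈ closedNbhd G l.toFinset, m ≤ (π₀ u : ℕ)) →
    open Classical in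
    (#{π | AgreesBelow π₀ m π ∧ EarliestAll G π l} : ℚ) = (k.factorial : ℚ) * prodTerm G l := by
  classical
  induction k with
  | zero =>
    intro π₀ m hm l _ _ hl
    cases l with
    | nil =>
      have : (univ.filter fun π => AgreesBelow π₀ m π ∧ EarliestAll G π []) = {π₀} := by
        ext π
        simp only [EarliestAll, and_true, mem_filter, mem_univ, true_and, mem_singleton]
        refine ⟨fun h => Equiv.ext fun v => h v (by have := (π₀ v).2; omega), ?_⟩
        rintro rfl v _
        rfl
      rw [this]
      simp [prodTerm]
    | cons v l =>
      have h1 := hl v (by simp [mem_closedNbhd])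
      have h2 := (π₀ v).2
      omega
  | succ k ih =>
    intro π₀ m hm l hnd hind hl
    rw [card_agreesBelow_eq_sum π₀ (by omega), Nat.cast_sum]
    cases l with
    | nil =>
      have h : ∀ w ∈ univ.filter (fun w => m ≤ (π₀ w : ℕ)),
          (#{π | (AgreesBelow π₀ m π ∧ (π w : ℕ) = m) ∧ EarliestAll G π []} : ℚ) =
            k.factorial := by
        intro w hw
        obtain ⟨π₁, h1, -⟩ := exists_agreesBelow_succ π₀ (mem_filter.1 hw).2
        simp only [← h1]
        rw [ih π₁ (m + 1) (by omega) [] hnd hind (by simp [mem_closedNbhd])]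
        simp [prodTerm]
      rw [sum_congr rfl h, sum_const, card_filter_le_apply π₀ hm]
      simp [prodTerm, Nat.factorial_succ]
    | cons v l =>
      set S := closedNbhd G (v :: l).toFinset with hS
      have hsub : closedNbhd G l.toFinset ⊆ S := by
        intro u hu
        rw [hS, mem_closedNbhd]
        rw [mem_closedNbhd] at hu
        rcases hu with hu | ⟨w, hw, hwu⟩
        · left
          simp_all
        · right
          exact ⟨w, by simp_all, hwu⟩
      have hvS : v ∈ S := by simp [hS, mem_closedNbhd]
      have hvl : v ∉ closedNbhd G l.toFinset := by
        rw [mem_closedNbhd]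
        rintro (h | ⟨w, hw, hwv⟩)
        · exact (List.nodup_cons.1 hnd).1 (by simpa using h)
        · exact hind w (by simp_all) v (by simp) hwv
      have hndl : l.Nodup := (List.nodup_cons.1 hnd).2
      have hindl : IsIndep G l.toFinset := fun a ha b hb =>
        hind a (by simp_all) b (by simp_all)
      have hcard : ∀ w ∈ univ.filter (fun w => m ≤ (π₀ w : ℕ)),
          (#{π | (AgreesBelow π₀ m π ∧ (π w : ℕ) = m) ∧ EarliestAll G π (v :: l)} : ℚ) =
            (if w = v then k.factorial * prodTerm G l else 0) +
              (if w ∉ S then k.factorial * prodTerm G (v :: l) else 0) := by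
        intro w hw
        obtain ⟨π₁, h1, h2⟩ := exists_agreesBelow_succ π₀ (mem_filter.1 hw).2
        by_cases hwv : w = v
        · subst hwv
          rw [if_pos rfl, if_neg (not_not.2 hvS), add_zero,
            ← ih π₁ (m + 1) (by omega) l hndl hindl fun u hu =>
              h2 u (fun h => hvl (h ▸ hu)) (hl u (hsub hu))]
          refine congrArg (fun s : Finset (V ≃ Fin (Fintype.card V)) => (#s : ℚ))
            (filter_congr fun π _ => ?_)
          simp only [h1, EarliestAll]
          refine ⟨fun h => ⟨h.1, h.2.2⟩, fun h => ⟨h.1, fun u hu huw => ?_, h.2⟩⟩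
          have h3 := h.1.1.le_apply (hl u hu)
          have h4 : (π u : ℕ) ≠ m := fun h5 =>
            huw (π.injective (Fin.ext (h5.trans h.1.2.symm)))
          have h5 := h.1.2
          rw [Fin.lt_def]
          omega
        · rw [if_neg hwv, zero_add]
          by_cases hwS : w ∈ S
          · rw [if_neg (not_not.2 hwS), Nat.cast_eq_zero, card_eq_zero,
              filter_eq_empty_iff]
            rintro π - ⟨⟨ha, hwm⟩, he, -⟩
            have h3 := he w hwS hwv
            have h4 := ha.le_apply (hl v hvS)
            rw [Fin.lt_def] at h3
            omega
          · rw [if_pos hwS]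
            simp only [← h1]
            exact ih π₁ (m + 1) (by omega) (v :: l) hnd hind fun u hu =>
              h2 u (fun h => hwS (h ▸ hu)) (hl u hu)
      rw [sum_congr rfl hcard, sum_add_distrib, sum_ite_eq', if_pos (by simpa using hl v hvS),
        ← sum_filter, sum_const, nsmul_eq_mul]
      have hcount : (#{w ∈ univ.filter (fun w => m ≤ (π₀ w : ℕ)) | w ∉ S} : ℚ) =
          (k + 1 : ℕ) - #S := by
        have hSs : S ⊆ univ.filter (fun w => m ≤ (π₀ w : ℕ)) := fun u hu => by
          simpa using hl u hu
        rw [filter_notMem_eq_sdiff, card_sdiff_of_subset hSs, Nat.cast_sub (card_le_card hSs),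
          card_filter_le_apply π₀ hm]
      have hS0 : (#S : ℚ) ≠ 0 := Nat.cast_ne_zero.2 (card_ne_zero_of_mem hvS)
      rw [hcount, prodTerm, card_sub_aPar, ← hS, Nat.factorial_succ]
      push_cast
      field_simp
      ring

/-- The number of orderings that realise `EarliestAll` of `l` and start outside the closed
neighbourhood of `l`. -/
theorem card_earliestAll_first (G : SimpleGraph V) [DecidableRel G.Adj] [Nonempty V]
    {l : List V} (hnd : l.Nodup) (hind : IsIndep G l.toFinset) :
    open Classical in
    (#{π : V ≃ Fin (Fintype.card V) | (∀ u ∈ closedNbhd G l.toFinset, (π u : ℕ) ≠ 0) ∧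
      EarliestAll G π l} : ℚ) =
      (Fintype.card V).factorial * (aPar G l.toFinset / Fintype.card V) * prodTerm G l := by
  classical
  have hpos : 0 < Fintype.card V := Fintype.card_pos
  obtain ⟨k, hk⟩ : ∃ k, 1 + k = Fintype.card V := ⟨Fintype.card V - 1, by omega⟩
  have π₀ := Fintype.equivFin V
  have hag : ∀ π, AgreesBelow π₀ 0 π := fun π v hv => absurd hv (Nat.not_lt_zero _)
  have h := card_agreesBelow_eq_sum π₀ hpos fun π =>
    (∀ u ∈ closedNbhd G l.toFinset, (π u : ℕ) ≠ 0) ∧ EarliestAll G π l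
  simp only [hag, true_and, Nat.zero_le, filter_true] at h
  have hterm : ∀ w : V, (#{π : V ≃ Fin (Fintype.card V) | (π w : ℕ) = 0 ∧
      (∀ u ∈ closedNbhd G l.toFinset, (π u : ℕ) ≠ 0) ∧ EarliestAll G π l} : ℚ) =
      if w ∉ closedNbhd G l.toFinset then k.factorial * prodTerm G l else 0 := by
    intro w
    by_cases hw : w ∈ closedNbhd G l.toFinset
    · rw [if_neg (not_not.2 hw), Nat.cast_eq_zero, card_eq_zero, filter_eq_empty_iff]
      rintro π - ⟨h0, hne, -⟩
      exact hne w hw h0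
    · rw [if_pos hw]
      obtain ⟨π₁, h1, h2⟩ := exists_agreesBelow_succ π₀ (Nat.zero_le (π₀ w : ℕ))
      rw [← card_agreesBelow_earliestAll G k π₁ 1 hk l hnd hind
        fun u hu => h2 u (fun h => hw (h ▸ hu)) (Nat.zero_le _)]
      refine congrArg (fun s : Finset (V ≃ Fin (Fintype.card V)) => (#s : ℚ))
        (filter_congr fun π _ => ?_)
      have h3 := h1 π
      simp only [zero_add, hag, true_and] at h3
      simp only [h3]
      refine ⟨fun h => ⟨h.1, h.2.2⟩, fun h => ⟨h.1, fun u hu h0 => hw ?_, h.2⟩⟩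
      rwa [π.injective (Fin.ext (h.1.trans h0.symm))]
  rw [h, Nat.cast_sum, sum_congr rfl fun w _ => hterm w, ← sum_filter, sum_const, nsmul_eq_mul,
    filter_notMem_eq_sdiff, ← compl_eq_univ_sdiff, card_compl, aPar]
  have h0 : (Fintype.card V : ℚ) ≠ 0 := Nat.cast_ne_zero.2 hpos.ne'
  have hf : ((Fintype.card V).factorial : ℚ) = Fintype.card V * k.factorial := by
    rw [← hk, add_comm, Nat.factorial_succ]
    push_cast
    ring
  rw [hf]
  field_simp

theorem EarliestAll.pairwise {G : SimpleGraph V} [DecidableRel G.Adj]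
    {π : V ≃ Fin (Fintype.card V)} {l : List V} (hnd : l.Nodup) (h : EarliestAll G π l) :
    l.Pairwise fun a b => π a < π b := by
  induction l with
  | nil => exact List.Pairwise.nil
  | cons v l ih =>
    rw [List.nodup_cons] at hnd
    refine List.pairwise_cons.2 ⟨fun u hu => h.1 u ?_ ?_, ih hnd.2 h.2⟩
    · simp [mem_closedNbhd, hu]
    · rintro rfl
      exact hnd.1 hu

theorem EarliestAll.lt_of_adj {G : SimpleGraph V} [DecidableRel G.Adj]
    {π : V ≃ Fin (Fintype.card V)} {l : List V} (h : EarliestAll G π l) :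
    ∀ v ∈ l, ∀ u, G.Adj u v → π v < π u := by
  induction l with
  | nil => simp
  | cons w l ih =>
    intro v hv u huv
    rcases List.mem_cons.1 hv with rfl | hv
    · exact h.1 u (by simp [mem_closedNbhd, huv.symm]) huv.ne
    · exact ih h.2 v hv u huv

theorem earliestAll_of_pairwise {G : SimpleGraph V} [DecidableRel G.Adj]
    {π : V ≃ Fin (Fintype.card V)} {l : List V} (hp : l.Pairwise fun a b => π a < π b)
    (h : ∀ v ∈ l, ∀ u, G.Adj u v → π v < π u) : EarliestAll G π l := by
  induction l with
  | nil => trivial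
  | cons w l ih =>
    rw [List.pairwise_cons] at hp
    refine ⟨fun u hu huw => ?_, ih hp.2 fun v hv => h v (List.mem_cons_of_mem _ hv)⟩
    rw [mem_closedNbhd] at hu
    simp only [List.toFinset_cons, mem_insert, List.mem_toFinset, exists_eq_or_imp] at hu
    rcases hu with (rfl | hu) | hu | ⟨v, hv, hvu⟩
    · exact absurd rfl huw
    · exact hp.1 u hu
    · exact h w (by simp) u hu.symm
    · exact (hp.1 v hv).trans (h v (List.mem_cons_of_mem _ hv) u hvu.symm)

/-- The vertices of `I` precede all their neighbours iff `EarliestAll` holds for exactly one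
arrangement of `I`. -/
theorem card_permutations_earliestAll (G : SimpleGraph V) [DecidableRel G.Adj]
    (π : V ≃ Fin (Fintype.card V)) (I : Finset V) :
    open Classical in
    #{ρ ∈ I.toList.permutations.toFinset | EarliestAll G π ρ} =
      if ∀ v ∈ I, ∀ u, G.Adj u v → π v < π u then 1 else 0 := by
  classical
  split_ifs with h
  · let l := I.toList.mergeSort fun a b => decide (π a ≤ π b)
    have hperm : l.Perm I.toList := List.mergeSort_perm _ _
    have hnd : l.Nodup := hperm.nodup_iff.2 I.nodup_toList
    have hle : l.Pairwise fun a b => π a ≤ π b := by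
      have := List.pairwise_mergeSort (le := fun a b => decide (π a ≤ π b))
        (fun a b c hab hbc => by simp only [decide_eq_true_eq] at *; exact hab.trans hbc)
        (fun a b => by simpa using le_total (π a) (π b)) I.toList
      simpa using this
    have hlt : l.Pairwise fun a b => π a < π b :=
      (hle.and hnd).imp fun h => lt_of_le_of_ne h.1 fun he => h.2 (π.injective he)
    rw [card_eq_one]
    refine ⟨l, ?_⟩
    ext ρ
    simp only [mem_filter, List.mem_toFinset, List.mem_permutations, mem_singleton]
    constructor
    · rintro ⟨hρ, he⟩
      have hρlt := he.pairwise (hρ.nodup_iff.2 I.nodup_toList)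
      exact (hρ.trans hperm.symm).eq_of_pairwise
        (fun a b _ _ hab hba => absurd (hab.trans hba) (lt_irrefl _)) hρlt hlt
    · rintro rfl
      exact ⟨hperm, earliestAll_of_pairwise hlt fun v hv =>
        h v (mem_toList.1 (hperm.mem_iff.1 hv))⟩
  · rw [card_eq_zero, filter_eq_empty_iff]
    intro ρ hρ he
    refine h fun v hv => he.lt_of_adj v ?_
    rw [List.mem_toFinset, List.mem_permutations] at hρ
    exact hρ.mem_iff.2 (mem_toList.2 hv)

theorem forall_isBad_iff (G : SimpleGraph V) [DecidableRel G.Adj]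
    (π : V ≃ Fin (Fintype.card V)) (I : Finset V) :
    (∀ v ∈ I, IsBad G π v) ↔ (∀ u ∈ closedNbhd G I, (π u : ℕ) ≠ 0) ∧
      ∀ v ∈ I, ∀ u, G.Adj u v → π v < π u := by
  constructor
  · refine fun h => ⟨fun u hu => ?_, fun v hv => (h v hv).2⟩
    rw [mem_closedNbhd] at hu
    rcases hu with hu | ⟨v, hv, hvu⟩
    · exact (h u hu).1
    · have := (h v hv).2 u hvu.symm
      rw [Fin.lt_def] at this
      omega
  · exact fun h v hv => ⟨h.1 v ((mem_closedNbhd G).2 (Or.inl hv)), h.2 v hv⟩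

/-- The number of orderings in which every vertex of an independent set is bad. -/
theorem card_forall_isBad (G : SimpleGraph V) [DecidableRel G.Adj] [Nonempty V]
    {I : Finset V} (hI : IsIndep G I) :
    open Classical in
    (#{π : V ≃ Fin (Fintype.card V) | ∀ v ∈ I, IsBad G π v} : ℚ) =
      (Fintype.card V).factorial * (aPar G I / Fintype.card V) * bPar G I := by
  classical
  have hnd : I.toList.permutations.Nodup := List.nodup_permutations _ I.nodup_toList
  have hρ : ∀ ρ ∈ I.toList.permutations.toFinset, ρ.Nodup ∧ ρ.toFinset = I := by
    intro ρ h
    rw [List.mem_toFinset, List.mem_permutations] at h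
    exact ⟨h.nodup_iff.2 I.nodup_toList, by rw [List.toFinset_eq_of_perm _ _ h, toList_toFinset]⟩
  rw [bPar, ← List.sum_toFinset _ hnd, mul_sum]
  have hsum : ∀ ρ ∈ I.toList.permutations.toFinset,
      ((Fintype.card V).factorial : ℚ) * (aPar G I / Fintype.card V) * prodTerm G ρ =
        #{π ∈ univ.filter (fun π : V ≃ Fin (Fintype.card V) =>
          ∀ u ∈ closedNbhd G I, (π u : ℕ) ≠ 0) | EarliestAll G π ρ} := by
    intro ρ h
    have := card_earliestAll_first G (hρ ρ h).1 (by rwa [(hρ ρ h).2])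
    rw [(hρ ρ h).2] at this
    rw [filter_filter, this]
  rw [sum_congr rfl hsum, ← Nat.cast_sum]
  congr 1
  have hdc := sum_card_bipartiteAbove_eq_sum_card_bipartiteBelow
    (s := univ.filter (fun π : V ≃ Fin (Fintype.card V) =>
      ∀ u ∈ closedNbhd G I, (π u : ℕ) ≠ 0))
    (t := I.toList.permutations.toFinset) (fun π ρ => EarliestAll G π ρ)
  simp only [bipartiteAbove, bipartiteBelow] at hdc
  rw [← hdc, sum_congr rfl fun π _ => card_permutations_earliestAll G π I, ← card_filter,
    filter_filter]
  congr 1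
  ext π
  simp only [mem_filter, mem_univ, true_and, forall_isBad_iff]

theorem isIndep_of_forall_isBad {G : SimpleGraph V} {π : V ≃ Fin (Fintype.card V)}
    {I : Finset V} (h : ∀ v ∈ I, IsBad G π v) : IsIndep G I := fun u hu v hv huv =>
  lt_asymm ((h u hu).2 v huv.symm) ((h v hv).2 u huv)

theorem isSuccessive_iff_forall_not_isBad (G : SimpleGraph V)
    (π : V ≃ Fin (Fintype.card V)) : IsSuccessive G π ↔ ∀ v, ¬ IsBad G π v := by
  refine forall_congr' fun v => ?_
  simp only [IsBad, not_and, not_forall, not_lt]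
  refine imp_congr_right fun _ => exists_congr fun u => ?_
  rw [exists_prop]
  exact and_congr_right fun h => ⟨le_of_lt, fun hle => lt_of_le_of_ne hle fun he =>
    h.ne (π.injective he)⟩

open Classical in
/-- Inclusion–exclusion over the sets of bad vertices. -/
theorem sigmaG_eq_sum_card_forall_isBad (G : SimpleGraph V) :
    (sigmaG G : ℚ) = ∑ I : Finset V, (-1 : ℚ) ^ #I *
      #{π : V ≃ Fin (Fintype.card V) | ∀ v ∈ I, IsBad G π v} := by
  have h1 : ∀ π : V ≃ Fin (Fintype.card V), (if IsSuccessive G π then (1 : ℚ) else 0) =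
      ∑ I : Finset V, (-1 : ℚ) ^ #I * if ∀ v ∈ I, IsBad G π v then 1 else 0 := by
    intro π
    have h2 := prod_add (fun v => -(if IsBad G π v then (1 : ℚ) else 0)) (fun _ => 1)
      (univ : Finset V)
    simp only [prod_const_one, mul_one, prod_neg, powerset_univ, prod_boole] at h2
    refine Eq.trans ?_ (h2.trans (sum_congr rfl fun I _ => by congr))
    simp only [isSuccessive_iff_forall_not_isBad]
    have h3 : ∀ v, -(if IsBad G π v then (1 : ℚ) else 0) + 1 = if ¬ IsBad G π v then 1 else 0 := by
      intro v
      split_ifs <;> simp_all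
    simp only [h3, prod_boole, mem_univ, true_imp_iff]
  rw [sigmaG, Nat.card_eq_fintype_card, Fintype.card_subtype, card_filter]
  push_cast
  rw [sum_congr rfl fun π _ => h1 π, sum_comm]
  refine sum_congr rfl fun I _ => ?_
  rw [← mul_sum, sum_boole]

/-- For a finite connected graph `G` on `n` vertices,
`σ(G) = n! · Σ_{I independent} (−1)^{|I|} (a(I)/n) b(I)`. -/
theorem successive_count_formula (G : SimpleGraph V) [DecidableRel G.Adj]
    (hG : G.Connected) :
    (sigmaG G : ℚ) =
      (Nat.factorial (Fintype.card V) : ℚ) *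
        ∑ I ∈ Finset.univ.filter (fun I : Finset V => IsIndep G I),
          (-1 : ℚ) ^ I.card * ((aPar G I : ℚ) / (Fintype.card V : ℚ)) * bPar G I := by
  classical
  have : Nonempty V := hG.nonempty
  rw [sigmaG_eq_sum_card_forall_isBad, mul_sum, sum_filter]
  refine sum_congr rfl fun I _ => ?_
  split_ifs with hI
  · rw [card_forall_isBad G hI]
    ring
  · rw [card_eq_zero.2 (filter_eq_empty_iff.2 fun π _ h => hI (isIndep_of_forall_isBad h))]
    simp
end

section
/- Let G = (V,E) be a fully regular finite simple graph with independence number α, and let a_0, a_1, …, a_α be the constants such that a(I) = a_{|I|} for every independent set I. Then for each 0 ≤ i ≤ α, the number of independent sets of G of size i equals (a_0 · a_1 · ⋯ · a_{i−1}) / i!. -/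
open Finset Polynomial

variable {V : Type*} [Fintype V] [DecidableEq V]

lemma IsIndep.mono {W : Type*} {G : SimpleGraph W} {I J : Finset W} (hJ : IsIndep G J) (h : I ⊆ J) :
    IsIndep G I :=
  fun u hu v hv => hJ u (h hu) v (h hv)

lemma mem_compl_closedNbhd (G : SimpleGraph V) [DecidableRel G.Adj] {I : Finset V} {v : V} :
    v ∈ (closedNbhd G I)ᶜ ↔ v ∉ I ∧ ∀ u ∈ I, ¬ G.Adj u v := by
  simp [closedNbhd]

lemma isIndep_insert_iff {W : Type*} [DecidableEq W] {G : SimpleGraph W} {I : Finset W}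
    (hI : IsIndep G I) {v : W} :
    IsIndep G (insert v I) ↔ ∀ u ∈ I, ¬ G.Adj u v := by
  constructor
  · intro h u hu
    exact h u (mem_insert_of_mem hu) v (mem_insert_self v I)
  · intro h x hx y hy hxy
    rcases mem_insert.1 hx with hxv | hx <;> rcases mem_insert.1 hy with hyv | hy
    · exact hxy.ne (hxv.trans hyv.symm)
    · exact h y hy (hxv ▸ hxy.symm)
    · exact h x hx (hyv ▸ hxy)
    · exact hI x hx y hy hxy

/-- An independent set `I` has exactly `a(I)` independent supersets with one more vertex. -/
lemma card_indep_supersets (G : SimpleGraph V) [DecidableRel G.Adj] {I : Finset V}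
    (hI : IsIndep G I) :
    (Finset.univ.filter fun J : Finset V =>
      (IsIndep G J ∧ J.card = I.card + 1) ∧ I ⊆ J).card = aPar G I := by
  rw [aPar, ← card_compl]
  symm
  refine card_bij (fun v _ => insert v I) ?_ ?_ ?_
  · intro v hv
    obtain ⟨hvI, hadj⟩ := (mem_compl_closedNbhd G).1 hv
    simp [(isIndep_insert_iff hI).2 hadj, card_insert_of_notMem hvI]
  · intro v hv w _ hvw
    have hvI := ((mem_compl_closedNbhd G).1 hv).1
    have hmem : v ∈ insert w I := hvw ▸ mem_insert_self v I
    exact (mem_insert.1 hmem).resolve_right hvI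
  · intro J hJ
    obtain ⟨⟨hJ, hcard⟩, hIJ⟩ := (mem_filter.1 hJ).2
    obtain ⟨v, hv, rfl⟩ := (Finset.covBy_iff_exists_insert).1
      ((Finset.covBy_iff_card_sdiff_eq_one).2
        ⟨hIJ, by rw [card_sdiff_of_subset hIJ, hcard, Nat.add_sub_cancel_left]⟩)
    exact ⟨v, (mem_compl_closedNbhd G).2 ⟨hv, (isIndep_insert_iff hI).1 hJ⟩, rfl⟩

/-- An independent set of size `i + 1` contains exactly `i + 1` independent sets of size `i`. -/
lemma card_indep_subsets (G : SimpleGraph V) [DecidableRel G.Adj] {J : Finset V} {i : ℕ}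
    (hJ : IsIndep G J) (hcard : J.card = i + 1) :
    (Finset.univ.filter fun I : Finset V => (IsIndep G I ∧ I.card = i) ∧ I ⊆ J).card = i + 1 := by
  have h : (Finset.univ.filter fun I : Finset V => (IsIndep G I ∧ I.card = i) ∧ I ⊆ J) =
      J.powersetCard i := by
    ext I
    simp only [mem_filter, mem_univ, true_and, mem_powersetCard]
    exact ⟨fun h => ⟨h.2, h.1.2⟩, fun h => ⟨⟨hJ.mono h.1, h.2⟩, h.1⟩⟩
  rw [h, card_powersetCard, hcard, Nat.choose_succ_self_right]

lemma indep_count_succ (G : SimpleGraph V) [DecidableRel G.Adj] {a : ℕ → ℕ}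
    (hreg : ∀ I : Finset V, IsIndep G I → aPar G I = a I.card) (i : ℕ) :
    (Finset.univ.filter fun I : Finset V => IsIndep G I ∧ I.card = i).card * a i =
      (Finset.univ.filter fun I : Finset V => IsIndep G I ∧ I.card = i + 1).card * (i + 1) := by
  refine card_mul_eq_card_mul (fun I J : Finset V => I ⊆ J) ?_ ?_
  · intro I hmem
    obtain ⟨hI, rfl⟩ := (mem_filter.1 hmem).2
    rw [bipartiteAbove, filter_filter, card_indep_supersets G hI, hreg I hI]
  · intro J hJ
    obtain ⟨hJ, hcard⟩ := (mem_filter.1 hJ).2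
    rw [bipartiteBelow, filter_filter, card_indep_subsets G hJ hcard]

/-- In a fully regular graph, the number of independent sets of size
`i ≤ α` equals `a₀a₁⋯a_{i−1}/i!`. -/
theorem fullyRegular_indep_count (G : SimpleGraph V) [DecidableRel G.Adj]
    (α : ℕ) (hmax : ∀ I : Finset V, IsIndep G I → I.card ≤ α)
    (hex : ∃ I : Finset V, IsIndep G I ∧ I.card = α)
    (a : ℕ → ℕ) (hreg : ∀ I : Finset V, IsIndep G I → aPar G I = a I.card) :
    ∀ i : ℕ, i ≤ α →
      ((Finset.univ.filter (fun I : Finset V => IsIndep G I ∧ I.card = i)).card : ℚ) =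
        (∏ j ∈ Finset.range i, (a j : ℚ)) / (Nat.factorial i : ℚ) := by
  intro i _
  rw [eq_div_iff (by positivity)]
  induction i with
  | zero =>
    have h : (Finset.univ.filter fun I : Finset V => IsIndep G I ∧ I.card = 0) = {∅} := by
      ext I
      simp only [mem_filter, mem_univ, true_and, card_eq_zero, mem_singleton]
      refine ⟨fun h => h.2, ?_⟩
      rintro rfl
      exact ⟨fun u hu => absurd hu (notMem_empty u), rfl⟩
    rw [h]
    simp
  | succ i ih =>
    have h : ((Finset.univ.filter fun I : Finset V => IsIndep G I ∧ I.card = i).card : ℚ) * a i =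
        (Finset.univ.filter fun I : Finset V => IsIndep G I ∧ I.card = i + 1).card * (i + 1) := by
      exact_mod_cast indep_count_succ G hreg i
    rw [prod_range_succ, ← ih (by omega), Nat.factorial_succ]
    push_cast
    linear_combination -(i.factorial : ℚ) * h
end

section
/- Let G = (V,E) be a finite simple graph, let S ⊆ V, and let G' = G − S. For each independent set I of G' define Δb_I := b_{G'}(I) − b_G(I), with Δb_∅ = 0. Then for every nonempty independent set I of G', |N_{G'}[I]| · Δb_I = Σ_{v ∈ I} Δb_{I∖{v}} + |N_G[I] ∩ S| · b_G(I). -/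
open Finset Polynomial

variable {V : Type*} [Fintype V] [DecidableEq V]

theorem toList_perm_cons_erase {α : Type*} [DecidableEq α] {I : Finset α} {v : α}
    (hv : v ∈ I) : I.toList.Perm (v :: (I.erase v).toList) := by
  conv_lhs => rw [← Finset.insert_erase hv]
  exact Finset.toList_insert (Finset.notMem_erase v I)

/-- A permutation of a finite set is a choice of first element followed by a permutation of
the remaining ones. -/
theorem permutations_toList_perm_flatMap {α : Type*} [DecidableEq α] {I : Finset α}
    (hI : I.Nonempty) :
    I.toList.permutations.Perm
      (I.toList.flatMap fun v => (I.erase v).toList.permutations.map (List.cons v)) := by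
  rw [List.perm_ext_iff_of_nodup (List.nodup_permutations _ I.nodup_toList)]
  · intro l
    simp only [List.mem_permutations, List.mem_flatMap, List.mem_map, Finset.mem_toList]
    constructor
    · intro h
      cases l with
      | nil => simp [hI.ne_empty] at h
      | cons v p =>
        have hv : v ∈ I := by
          rw [← Finset.mem_toList, ← h.mem_iff]
          exact List.mem_cons_self
        exact ⟨v, hv, p, List.Perm.cons_inv (h.trans (toList_perm_cons_erase hv)), rfl⟩
    · rintro ⟨v, hv, p, hp, rfl⟩
      exact (hp.cons v).trans (toList_perm_cons_erase hv).symm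
  · rw [List.nodup_flatMap]
    refine ⟨fun v _ => (List.nodup_permutations _ (Finset.nodup_toList _)).map
      List.cons_injective, I.nodup_toList.imp fun {u v} huv => ?_⟩
    intro l hu hv
    simp only [List.mem_map] at hu hv
    obtain ⟨p, -, rfl⟩ := hu
    obtain ⟨q, -, h⟩ := hv
    exact huv (List.cons.inj h).1.symm

/-- The recursion for `b` in the induced subgraph on `W`, obtained by splitting permutations
according to their first element. -/
theorem card_closW_mul_bW (G : SimpleGraph V) [DecidableRel G.Adj] {W I : Finset V}
    (hIW : I ⊆ W) (hI : I.Nonempty) :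
    ((closW G W I).card : ℚ) * bW G W I = ∑ v ∈ I, bW G W (I.erase v) := by
  have hne : ((closW G W I).card : ℚ) ≠ 0 := by
    obtain ⟨v, hv⟩ := hI
    rw [Nat.cast_ne_zero]
    exact Finset.card_ne_zero_of_mem
      (Finset.mem_inter.2 ⟨Finset.mem_union_left _ hv, hIW hv⟩)
  have hle : (closW G W I).card ≤ W.card := Finset.card_le_card Finset.inter_subset_right
  have key : bW G W I = ∑ v ∈ I, ((closW G W I).card : ℚ)⁻¹ * bW G W (I.erase v) := by
    rw [bW, ((permutations_toList_perm_flatMap hI).map _).sum_eq, List.map_flatMap,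
      List.flatMap_def, List.sum_flatten, List.map_map,
      Finset.sum_map_toList]
    refine Finset.sum_congr rfl fun v hv => ?_
    rw [bW, ← List.sum_map_mul_left, Function.comp_apply, List.map_map]
    congr 1
    refine List.map_congr_left fun p hp => ?_
    have hset : (v :: p).toFinset = I := by
      rw [List.toFinset_cons, List.toFinset_eq_of_perm _ _ (List.mem_permutations.1 hp),
        Finset.toList_toFinset, Finset.insert_erase hv]
    rw [Function.comp_apply, prodTermW, hset, aW, Nat.cast_sub hle, sub_sub_cancel, one_div]
  rw [key, ← Finset.mul_sum, mul_inv_cancel_left₀ hne]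

/-- For `S ⊆ V`, `G' = G − S` and `Δb_I := b_{G'}(I) − b_G(I)`, every
nonempty independent set `I` of `G'` satisfies
`|N_{G'}[I]| · Δb_I = Σ_{v ∈ I} Δb_{I∖{v}} + |N_G[I] ∩ S| · b_G(I)`. Here the data of
the induced subgraph `G − S` is encoded by computing all parameters relative to the
vertex set `univ \ S`. -/
theorem delta_b_recursion (G : SimpleGraph V) [DecidableRel G.Adj] (S : Finset V) :
    ∀ I ∈ (Finset.univ \ S).powerset, IsIndep G I → I.Nonempty →
      ((closW G (Finset.univ \ S) I).card : ℚ) *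
          (bW G (Finset.univ \ S) I - bW G Finset.univ I) =
        (∑ v ∈ I,
          (bW G (Finset.univ \ S) (I.erase v) - bW G Finset.univ (I.erase v))) +
          ((closedNbhd G I ∩ S).card : ℚ) * bW G Finset.univ I := by
  intro I hI _ hne
  have hW := card_closW_mul_bW G (Finset.mem_powerset.1 hI) hne
  have hV := card_closW_mul_bW G (Finset.subset_univ I) hne
  have hcard : ((closW G Finset.univ I).card : ℚ) =
      (closW G (Finset.univ \ S) I).card + (closedNbhd G I ∩ S).card := by
    have h := Finset.card_inter_add_card_sdiff (closedNbhd G I) S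
    have hsdiff : closedNbhd G I ∩ (Finset.univ \ S) = closedNbhd G I \ S := by
      ext; simp
    rw [closW, closW, hsdiff, Finset.inter_univ, ← h]
    push_cast
    ring
  rw [hcard] at hV
  rw [Finset.sum_sub_distrib, ← hW, ← hV]
  ring
end
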